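/- With the Q-polynomial distance-regular graph setup, fix an orthogonal direct sum decomposition V = Σ_W W of the standard module into irreducible T-modules. Then for 0 ≤ i,j ≤ D: Ṽ^{↓↓}_{i,j} = Σ W^{↓↓}_h, where the sum is over all ordered pairs (W,h) such that W occurs in the decomposition with endpoint ρ ≤ i, dual endpoint τ = i + j − ρ − d, diameter d ≥ i − ρ, and h = i − ρ. -/

import Mathlib

noncomputable section

open Matrix Finset
open scoped ComplexInnerProductSpace

/-- A `Q`-polynomial distance-regular graph setup: a finite connected simple graph `G` on `X`
with diameter `D ≥ 3`, intersection numbers `p h i j`, primitive idempotents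
`E 0, …, E D` of the Bose–Mesner algebra with (distinct, real) eigenvalues `θ 0, …, θ D`,
and Krein parameters `q h i j` satisfying the `Q`-polynomial condition with respect to the
ordering `E 0, …, E D`. -/
structure QPolyDRG (X : Type*) [Fintype X] [DecidableEq X] where
  G : SimpleGraph X
  conn : G.Connected
  D : ℕ
  hD3 : 3 ≤ D
  dist_le : ∀ y z : X, G.dist y z ≤ D
  dist_eq : ∃ y z : X, G.dist y z = D
  p : ℕ → ℕ → ℕ → ℕ
  hp : ∀ h i j : ℕ, h ≤ D → i ≤ D → j ≤ D → ∀ y z : X, G.dist y z = h →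
    Nat.card {w : X // G.dist y w = i ∧ G.dist w z = j} = p h i j
  E : ℕ → Matrix X X ℂ
  θ : ℕ → ℝ
  q : ℕ → ℕ → ℕ → ℝ
  hE0 : E 0 = ((Fintype.card X : ℂ))⁻¹ • Matrix.of (fun _ _ => (1 : ℂ))
  hEsum : ∑ i ∈ Finset.range (D + 1), E i = 1
  hEmul : ∀ i ≤ D, ∀ j ≤ D, E i * E j = if i = j then E i else 0
  hEsym : ∀ i ≤ D, (E i)ᵀ = E i
  hEreal : ∀ i ≤ D, ∀ y z : X, ((E i) y z).im = 0
  hEinM : ∀ i ≤ D, E i ∈ Submodule.span ℂ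
    {B : Matrix X X ℂ | ∃ k ≤ D, B = Matrix.of (fun y z => if G.dist y z = k then (1 : ℂ) else 0)}
  hAE : ∀ i ≤ D,
    Matrix.of (fun y z => if G.dist y z = 1 then (1 : ℂ) else 0) * E i = (θ i : ℂ) • E i
  θ_inj : ∀ i ≤ D, ∀ j ≤ D, θ i = θ j → i = j
  hKrein : ∀ i ≤ D, ∀ j ≤ D, Matrix.hadamard (E i) (E j) =
    ((Fintype.card X : ℂ))⁻¹ • ∑ h ∈ Finset.range (D + 1), (q h i j : ℂ) • E h
  hq_zero : ∀ h ≤ D, ∀ i ≤ D, ∀ j ≤ D, (i + j < h ∨ h + j < i ∨ h + i < j) → q h i j = 0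
  hq_ne : ∀ h ≤ D, ∀ i ≤ D, ∀ j ≤ D, (h = i + j ∨ i = h + j ∨ j = h + i) → q h i j ≠ 0

namespace QPolyDRG

variable {X : Type*} [Fintype X] [DecidableEq X] (S : QPolyDRG X) (x : X)

/-- The `i`-th distance matrix `A_i`. -/
def Amat (i : ℕ) : Matrix X X ℂ :=
  Matrix.of (fun y z => if S.G.dist y z = i then (1 : ℂ) else 0)

/-- The adjacency matrix `A = A_1`. -/
def adj : Matrix X X ℂ := S.Amat 1

/-- The `i`-th dual idempotent `E*_i = E*_i(x)` with respect to the base vertex `x`. -/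
def Estar (i : ℕ) : Matrix X X ℂ :=
  Matrix.diagonal (fun y => if S.G.dist x y = i then (1 : ℂ) else 0)

/-- The dual adjacency matrix `A* = A*(x)`, with `(A*)_{yy} = |X| (E_1)_{xy}`. -/
def Astar : Matrix X X ℂ :=
  Matrix.diagonal (fun y => (Fintype.card X : ℂ) * S.E 1 x y)

/-- The subspace `E_i V` of the standard module, with the convention that it is `0`
for `i ∉ {0, …, D}`. -/
def EV (i : ℤ) : Submodule ℂ (EuclideanSpace ℂ X) :=
  if 0 ≤ i ∧ i ≤ S.D then LinearMap.range (Matrix.toEuclideanLin (S.E i.toNat)) else ⊥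

/-- The `i`-th subconstituent `E*_i V` with respect to `x`, with the convention that it is `0`
for `i ∉ {0, …, D}`. -/
def EstarV (i : ℤ) : Submodule ℂ (EuclideanSpace ℂ X) :=
  if 0 ≤ i ∧ i ≤ S.D then LinearMap.range (Matrix.toEuclideanLin (S.Estar x i.toNat)) else ⊥

/-- The subconstituent (Terwilliger) algebra `T = T(x)`, generated by `A` and `A*`. -/
def Talg : Subalgebra ℂ (Matrix X X ℂ) := Algebra.adjoin ℂ {S.adj, S.Astar x}

/-- A `T`-module: a subspace `W ⊆ V` with `B W ⊆ W` for all `B ∈ T`. -/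
def IsTModule (W : Submodule ℂ (EuclideanSpace ℂ X)) : Prop :=
  ∀ B ∈ S.Talg x, ∀ w ∈ W, Matrix.toEuclideanLin B w ∈ W

/-- An irreducible `T`-module. -/
def IsIrredTModule (W : Submodule ℂ (EuclideanSpace ℂ X)) : Prop :=
  S.IsTModule x W ∧ W ≠ ⊥ ∧ ∀ W' ≤ W, S.IsTModule x W' → W' = ⊥ ∨ W' = W

/-- The subspace `E_i W`, with the convention that it is `0` for `i ∉ {0, …, D}`. -/
def EW (W : Submodule ℂ (EuclideanSpace ℂ X)) (i : ℤ) : Submodule ℂ (EuclideanSpace ℂ X) :=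
  if 0 ≤ i ∧ i ≤ S.D then Submodule.map (Matrix.toEuclideanLin (S.E i.toNat)) W else ⊥

/-- The subspace `E*_i W`, with the convention that it is `0` for `i ∉ {0, …, D}`. -/
def EstarW (W : Submodule ℂ (EuclideanSpace ℂ X)) (i : ℤ) : Submodule ℂ (EuclideanSpace ℂ X) :=
  if 0 ≤ i ∧ i ≤ S.D then Submodule.map (Matrix.toEuclideanLin (S.Estar x i.toNat)) W else ⊥


/-- The endpoint `ρ = min { i : E*_i W ≠ 0 }` of a `T`-module `W`. -/
def endpt (W : Submodule ℂ (EuclideanSpace ℂ X)) : ℕ :=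
  sInf {i : ℕ | i ≤ S.D ∧ S.EstarW x W i ≠ ⊥}

/-- The dual endpoint `τ = min { i : E_i W ≠ 0 }` of a `T`-module `W`. -/
def dualEndpt (W : Submodule ℂ (EuclideanSpace ℂ X)) : ℕ :=
  sInf {i : ℕ | i ≤ S.D ∧ S.EW W i ≠ ⊥}

/-- The diameter `d = |{ i : E*_i W ≠ 0 }| - 1` of a `T`-module `W`. -/
def diam (W : Submodule ℂ (EuclideanSpace ℂ X)) : ℕ :=
  Set.ncard {i : ℕ | i ≤ S.D ∧ S.EstarW x W i ≠ ⊥} - 1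

/-- The dual diameter `|{ i : E_i W ≠ 0 }| - 1` of a `T`-module `W`. -/
def dualDiam (W : Submodule ℂ (EuclideanSpace ℂ X)) : ℕ :=
  Set.ncard {i : ℕ | i ≤ S.D ∧ S.EW W i ≠ ⊥} - 1

/-- The split subspace `W^{μν}_h` of an irreducible `T`-module `W` with endpoint `ρ`,
dual endpoint `τ` and diameter `d`.  Here `μ = false` stands for `↓` and `μ = true`
for `↑`, and similarly for `ν`; e.g.
`W^{↓↓}_h = (E*_ρ W + ⋯ + E*_{ρ+h} W) ∩ (E_τ W + ⋯ + E_{τ+d-h} W)`. -/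
def Wsplit (W : Submodule ℂ (EuclideanSpace ℂ X)) (ρ τ d : ℕ) (μ ν : Bool) (h : ℕ) :
    Submodule ℂ (EuclideanSpace ℂ X) :=
  (if μ then ⨆ k ∈ Finset.Icc (ρ + d - h) (ρ + d), S.EstarW x W k
    else ⨆ k ∈ Finset.Icc ρ (ρ + h), S.EstarW x W k) ⊓
  (if ν then ⨆ k ∈ Finset.Icc (τ + h) (τ + d), S.EW W k
    else ⨆ k ∈ Finset.Icc τ (τ + d - h), S.EW W k)

/-- The subspace `V^{μν}_{i,j}` (interpreted as `0` if `i = -1` or `j = -1`).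
Here `μ = false` stands for `↓` and `μ = true` for `↑`, and similarly for `ν`; e.g.
`V^{↓↓}_{i,j} = (E*_0 V + ⋯ + E*_i V) ∩ (E_0 V + ⋯ + E_j V)` and
`V^{↑↑}_{i,j} = (E*_D V + ⋯ + E*_{D-i} V) ∩ (E_D V + ⋯ + E_{D-j} V)`. -/
def Vsplit (μ ν : Bool) (i j : ℤ) : Submodule ℂ (EuclideanSpace ℂ X) :=
  if 0 ≤ i ∧ 0 ≤ j then
    (if μ then ⨆ k ∈ Finset.Icc (S.D - i.toNat) S.D, S.EstarV x k
      else ⨆ k ∈ Finset.range (i.toNat + 1), S.EstarV x k) ⊓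
    (if ν then ⨆ k ∈ Finset.Icc (S.D - j.toNat) S.D, S.EV k
      else ⨆ k ∈ Finset.range (j.toNat + 1), S.EV k)
  else ⊥

/-- The subspace `Ṽ^{μν}_{i,j}`: the orthogonal complement of
`V^{μν}_{i-1,j} + V^{μν}_{i,j-1}` in `V^{μν}_{i,j}` with respect to the standard
Hermitian form. -/
def tildeV (μ ν : Bool) (i j : ℕ) : Submodule ℂ (EuclideanSpace ℂ X) :=
  S.Vsplit x μ ν i j ⊓ (S.Vsplit x μ ν ((i : ℤ) - 1) j ⊔ S.Vsplit x μ ν i ((j : ℤ) - 1))ᗮ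

end QPolyDRG

structure TDS (V : Type*) [AddCommGroup V] [Module ℂ V] where
  D : ℕ
  e : ℕ → Module.End ℂ V
  es : ℕ → Module.End ℂ V
  A : Module.End ℂ V
  As : Module.End ℂ V
  θ : ℕ → ℂ
  θs : ℕ → ℂ
  e_sum : ∀ v, ∑ i ∈ Finset.range (D+1), e i v = v
  es_sum : ∀ v, ∑ i ∈ Finset.range (D+1), es i v = v
  e_mul : ∀ i ≤ D, ∀ j ≤ D, ∀ v, e i (e j v) = if i = j then e i v else 0
  es_mul : ∀ i ≤ D, ∀ j ≤ D, ∀ v, es i (es j v) = if i = j then es i v else 0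
  e_A : ∀ i ≤ D, ∀ v, e i (A v) = θ i • e i v
  es_As : ∀ i ≤ D, ∀ v, es i (As v) = θs i • es i v
  e_mem : ∀ i ≤ D, e i ∈ Algebra.adjoin ℂ {A}
  es_mem : ∀ i ≤ D, es i ∈ Algebra.adjoin ℂ {As}
  tri : ∀ k ≤ D, ∀ l ≤ D, l + 1 < k → ∀ v, e k (As (e l v)) = 0
  tris : ∀ k ≤ D, ∀ l ≤ D, l + 1 < k → ∀ v, es k (A (es l v)) = 0

namespace TDS
variable {V : Type*} [AddCommGroup V] [Module ℂ V]

def swap (S : TDS V) : TDS V where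
  D := S.D
  e := S.es
  es := S.e
  A := S.As
  As := S.A
  θ := S.θs
  θs := S.θ
  e_sum := S.es_sum
  es_sum := S.e_sum
  e_mul := S.es_mul
  es_mul := S.e_mul
  e_A := S.es_As
  es_As := S.e_A
  e_mem := S.es_mem
  es_mem := S.e_mem
  tri := S.tris
  tris := S.tri

def Q (S : TDS V) (j : ℤ) : Submodule ℂ V where
  carrier := {v | ∀ k ≤ S.D, j < k → S.e k v = 0}
  add_mem' := by
    intro a b ha hb k hk hj
    rw [map_add, ha k hk hj, hb k hk hj, add_zero]
  zero_mem' := by intro k _ _; simp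
  smul_mem' := by
    intro c a ha k hk hj
    rw [map_smul, ha k hk hj, smul_zero]

def P (S : TDS V) (j : ℤ) : Submodule ℂ V := S.swap.Q j

variable (S : TDS V)

theorem mem_Q {j : ℤ} {v : V} : v ∈ S.Q j ↔ ∀ k ≤ S.D, j < k → S.e k v = 0 := Iff.rfl
theorem mem_P {j : ℤ} {v : V} : v ∈ S.P j ↔ ∀ k ≤ S.D, j < k → S.es k v = 0 := Iff.rfl

theorem Q_mono {i j : ℤ} (h : i ≤ j) : S.Q i ≤ S.Q j := fun _ hv k hk hj => hv k hk (by omega)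
theorem P_mono {i j : ℤ} (h : i ≤ j) : S.P i ≤ S.P j := S.swap.Q_mono h

theorem A_Q {j : ℤ} {v : V} (hv : v ∈ S.Q j) : S.A v ∈ S.Q j := by
  intro k hk hj
  rw [S.e_A k hk, hv k hk hj, smul_zero]

theorem A_sub_Q {j : ℤ} {v : V} (hv : v ∈ S.Q j) : S.A v - S.θ j.toNat • v ∈ S.Q (j-1) := by
  intro k hk hj
  rw [map_sub, map_smul, S.e_A k hk]
  by_cases h : j < k
  · rw [hv k hk h]; simp
  · have : j.toNat = k := by omega
    rw [this, sub_self]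

theorem As_Q_gen {j : ℤ} {m : ℤ} (hm : m + 1 ≤ j) {v : V} (hv : v ∈ S.Q m) :
    S.As v ∈ S.Q j := by
  intro k hk hj
  conv_lhs => rw [← S.e_sum v]
  rw [map_sum, map_sum]
  apply Finset.sum_eq_zero
  intro l hl
  have hl' : l ≤ S.D := by simpa [Nat.lt_succ_iff] using hl
  by_cases h : m < l
  · rw [hv l hl' h]; simp
  · exact S.tri k hk l hl' (by omega) v

theorem As_Q {j : ℤ} {v : V} (hv : v ∈ S.Q j) : S.As v ∈ S.Q (j+1) :=
  S.As_Q_gen le_rfl hv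

structure Irr (W : Submodule ℂ V) : Prop where
  hA : ∀ w ∈ W, S.A w ∈ W
  hAs : ∀ w ∈ W, S.As w ∈ W
  ne : W ≠ ⊥
  irr : ∀ N ≤ W, (∀ w ∈ N, S.A w ∈ N) → (∀ w ∈ N, S.As w ∈ N) → N = ⊥ ∨ N = W

variable {S}
theorem Irr.swap {W : Submodule ℂ V} (h : S.Irr W) : S.swap.Irr W :=
  ⟨h.hAs, h.hA, h.ne, fun N hN h1 h2 => h.irr N hN h2 h1⟩

theorem adjoin_inv {A B : Module.End ℂ V} (W : Submodule ℂ V) (hA : ∀ w ∈ W, A w ∈ W)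
    (hB : B ∈ Algebra.adjoin ℂ {A}) : ∀ w ∈ W, B w ∈ W := by
  induction hB using Algebra.adjoin_induction with
  | mem x hx => rw [Set.mem_singleton_iff] at hx; subst hx; exact hA
  | algebraMap r => intro w hw; simpa [Module.algebraMap_end_apply] using W.smul_mem r hw
  | add x y _ _ hx hy => intro w hw; exact W.add_mem (hx w hw) (hy w hw)
  | mul x y _ _ hx hy => intro w hw; exact hx _ (hy w hw)

theorem Irr.e_mem {W : Submodule ℂ V} (h : S.Irr W) {k : ℕ} (hk : k ≤ S.D) :
    ∀ w ∈ W, S.e k w ∈ W := adjoin_inv W h.hA (S.e_mem k hk)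

variable (S)
def supp (W : Submodule ℂ V) : Set ℕ := {i | i ≤ S.D ∧ ∃ w ∈ W, S.e i w ≠ 0}
variable {S}

theorem eq_zero_of_e {v : V} (h : ∀ k ≤ S.D, S.e k v = 0) : v = 0 := by
  rw [← S.e_sum v]
  exact Finset.sum_eq_zero fun k hk => h k (by simpa [Nat.lt_succ_iff] using hk)

theorem Irr.e_zero {W : Submodule ℂ V} {k : ℕ} (hk : k ≤ S.D) (hs : k ∉ S.supp W) {w : V}
    (hw : w ∈ W) : S.e k w = 0 := by
  by_contra h
  exact hs ⟨hk, w, hw, h⟩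

theorem Irr.contig {W : Submodule ℂ V} (h : S.Irr W) :
    ∃ τ δ, S.supp W = Set.Icc τ (τ+δ) := by
  have hne : (S.supp W).Nonempty := by
    by_contra hc
    rw [Set.not_nonempty_iff_eq_empty] at hc
    apply h.ne
    rw [Submodule.eq_bot_iff]
    intro w hw
    exact eq_zero_of_e (S := S) fun k hk => Irr.e_zero hk (by rw [hc]; exact id) hw
  have hfin : (S.supp W).Finite := (Set.finite_Iic S.D).subset fun i hi => hi.1
  obtain ⟨τ, hτ, hτm⟩ := hfin.exists_minimal hne
  obtain ⟨M, hM, hMm⟩ := hfin.exists_maximal hne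
  have h1 : ∀ i ∈ S.supp W, τ ≤ i := fun i hi => by
    by_contra hc; exact hc (hτm hi (by omega))
  have h2 : ∀ i ∈ S.supp W, i ≤ M := fun i hi => by
    by_contra hc; exact hc (hMm hi (by omega))
  have hτM := h1 M hM
  refine ⟨τ, M - τ, Set.Subset.antisymm (fun i hi => ⟨h1 i hi, by have := h2 i hi; omega⟩) ?_⟩
  rintro m ⟨hm1, hm2⟩
  by_contra hm
  have hmD : m ≤ S.D := by have := hM.1; omega
  have hmτ : m ≠ τ := by rintro rfl; exact hm hτ
  have hmM : m ≠ M := by rintro rfl; exact hm hM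
  have key : ∀ w ∈ W ⊓ S.Q m, w ∈ S.Q ((m:ℤ)-1) := by
    rintro w ⟨hw, hq⟩ k hk hj
    by_cases hkm : k = m
    · subst hkm; exact Irr.e_zero hk hm hw
    · exact hq k hk (by omega)
  rcases h.irr (W ⊓ S.Q m) inf_le_left (fun w hw => ⟨h.hA w hw.1, S.A_Q hw.2⟩)
    (fun w hw => ⟨h.hAs w hw.1, S.As_Q_gen (by omega) (key w hw)⟩) with h0 | h0
  · obtain ⟨hτD, w, hw, hw0⟩ := hτ
    apply hw0
    rw [← Submodule.mem_bot ℂ, ← h0]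
    refine ⟨h.e_mem hτD w hw, fun k hk hj => ?_⟩
    rw [S.e_mul k hk τ hτD, if_neg (by omega)]
  · obtain ⟨hMD, w, hw, hw0⟩ := hM
    rw [← h0] at hw
    exact hw0 (hw.2 M hMD (by omega))

/-- diagonal sum -/
def diag (S : TDS V) (W : Submodule ℂ V) (r : ℤ) : Submodule ℂ V :=
  ⨆ i : ℤ, W ⊓ (S.P i ⊓ S.Q (r - i))

theorem U_A {W : Submodule ℂ V} (h : S.Irr W) {i j : ℤ} {v : V} (hv : v ∈ W ⊓ (S.P i ⊓ S.Q j)) :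
    S.A v - S.θ j.toNat • v ∈ W ⊓ (S.P (i+1) ⊓ S.Q (j-1)) :=
  ⟨W.sub_mem (h.hA v hv.1) (W.smul_mem _ hv.1),
   (S.P (i+1)).sub_mem (S.swap.As_Q hv.2.1) ((S.P (i+1)).smul_mem _ (S.P_mono (by omega) hv.2.1)),
   S.A_sub_Q hv.2.2⟩

theorem diag_swap (W : Submodule ℂ V) (r : ℤ) : S.swap.diag W r = S.diag W r := by
  unfold diag
  apply le_antisymm
  · refine iSup_le fun i => ?_
    refine le_iSup_of_le (r - i) ?_
    rintro v ⟨h1, h2, h3⟩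
    exact ⟨h1, h3, by rw [sub_sub_cancel]; exact h2⟩
  · refine iSup_le fun i => ?_
    refine le_iSup_of_le (r - i) ?_
    rintro v ⟨h1, h2, h3⟩
    exact ⟨h1, h3, by rw [sub_sub_cancel]; exact h2⟩

theorem diag_A {W : Submodule ℂ V} (h : S.Irr W) (r : ℤ) : ∀ v ∈ S.diag W r, S.A v ∈ S.diag W r := by
  intro v hv
  have : S.diag W r ≤ (S.diag W r).comap S.A := by
    conv_lhs => unfold diag
    refine iSup_le fun i => ?_
    intro v hv
    have h1 := U_A h hv
    have h2 : W ⊓ (S.P (i+1) ⊓ S.Q (r - i - 1)) ≤ S.diag W r := by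
      refine le_iSup_of_le (i+1) ?_
      rw [sub_sub]
    have h3 : v ∈ S.diag W r := (le_iSup (fun i => W ⊓ (S.P i ⊓ S.Q (r - i))) i) hv
    have := (S.diag W r).add_mem (h2 h1) ((S.diag W r).smul_mem (S.θ (r-i).toNat) h3)
    simpa using this
  exact this hv

theorem diag_le {W : Submodule ℂ V} (r : ℤ) : S.diag W r ≤ W := iSup_le fun _ => inf_le_left

theorem diag_dich {W : Submodule ℂ V} (h : S.Irr W) (r : ℤ) : S.diag W r = ⊥ ∨ S.diag W r = W := by
  refine h.irr _ (diag_le r) (diag_A h r) ?_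
  rw [← diag_swap]
  exact diag_A h.swap r

theorem Q_lt_zero {W : Submodule ℂ V} {τ δ : ℕ} (hs : S.supp W = Set.Icc τ (τ+δ)) {j : ℤ}
    (hj : j < τ) {v : V} (hv : v ∈ W) (hq : v ∈ S.Q j) : v = 0 := by
  refine eq_zero_of_e (S := S) fun k hk => ?_
  by_cases h : j < k
  · exact hq k hk h
  · exact Irr.e_zero hk (by rw [hs, Set.mem_Icc]; omega) hv

theorem diag_bot {W : Submodule ℂ V} (h : S.Irr W) {τ δ ρ d : ℕ}
    (hs : S.supp W = Set.Icc τ (τ+δ)) (hs' : S.swap.supp W = Set.Icc ρ (ρ+d))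
    {r : ℤ} (hr : r < ρ + τ + d) : S.diag W r = ⊥ := by
  rcases diag_dich h r with h0 | h0
  · exact h0
  exfalso
  have hm : ρ + d ∈ S.swap.supp W := by rw [hs', Set.mem_Icc]; omega
  obtain ⟨hD, w, hw, hw0⟩ := hm
  apply hw0
  rw [← h0] at hw
  have : S.diag W r ≤ LinearMap.ker (S.swap.e (ρ+d)) := by
    refine iSup_le fun i => ?_
    rintro v ⟨h1, h2, h3⟩
    rw [LinearMap.mem_ker]
    by_cases hi : i < (ρ + d : ℕ)
    · exact h2 _ hD hi
    · rw [Q_lt_zero hs (by omega) h1 h3, map_zero]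
  exact this hw

theorem diam_le {W : Submodule ℂ V} (h : S.Irr W) {τ δ ρ d : ℕ}
    (hs : S.supp W = Set.Icc τ (τ+δ)) (hs' : S.swap.supp W = Set.Icc ρ (ρ+d)) : d ≤ δ := by
  by_contra hc
  have hb := diag_bot h hs hs' (r := ρ + τ + δ) (by omega)
  have hm : ρ ∈ S.swap.supp W := by rw [hs', Set.mem_Icc]; omega
  obtain ⟨hD, w, hw, hw0⟩ := hm
  apply hw0
  rw [← Submodule.mem_bot ℂ, ← hb]
  refine (le_iSup (fun i => W ⊓ (S.P i ⊓ S.Q (ρ + τ + δ - i))) (ρ:ℤ)) ?_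
  have hmem := h.swap.e_mem hD w hw
  refine ⟨hmem, fun k hk hj => ?_, fun k hk hj => ?_⟩
  · rw [S.swap.e_mul k hk ρ hD, if_neg (by omega)]
  · exact Irr.e_zero hk (by rw [hs, Set.mem_Icc]; omega) hmem

theorem diam_eq {W : Submodule ℂ V} (h : S.Irr W) {τ δ ρ d : ℕ}
    (hs : S.supp W = Set.Icc τ (τ+δ)) (hs' : S.swap.supp W = Set.Icc ρ (ρ+d)) : d = δ :=
  le_antisymm (diam_le h hs hs') (diam_le h.swap hs' hs)

theorem L1 {W : Submodule ℂ V} (h : S.Irr W) {τ δ ρ d : ℕ}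
    (hs : S.supp W = Set.Icc τ (τ+δ)) (hs' : S.swap.supp W = Set.Icc ρ (ρ+d)) {i j : ℤ}
    (hij : i + j < ρ + τ + d ∨ i < ρ ∨ j < τ) {v : V} (hv : v ∈ W) (hP : v ∈ S.P i)
    (hQ : v ∈ S.Q j) : v = 0 := by
  rcases hij with hij | hij | hij
  · rw [← Submodule.mem_bot ℂ, ← diag_bot h hs hs' hij]
    refine (le_iSup (fun i' => W ⊓ (S.P i' ⊓ S.Q (i + j - i'))) i) ?_
    refine ⟨hv, hP, by rwa [add_sub_cancel_left]⟩
  · exact Q_lt_zero hs' hij hv hP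
  · exact Q_lt_zero hs hij hv hQ

theorem diag_top {W : Submodule ℂ V} (h : S.Irr W) {τ δ ρ d : ℕ}
    (hs : S.supp W = Set.Icc τ (τ+δ)) (hs' : S.swap.supp W = Set.Icc ρ (ρ+d)) :
    S.diag W (ρ + τ + d) = W := by
  rcases diag_dich h (ρ + τ + d) with h0 | h0
  swap
  · exact h0
  exfalso
  have hd := diam_eq h hs hs'
  have hm : ρ ∈ S.swap.supp W := by rw [hs', Set.mem_Icc]; omega
  obtain ⟨hD, w, hw, hw0⟩ := hm
  apply hw0
  rw [← Submodule.mem_bot ℂ, ← h0]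
  refine (le_iSup (fun i => W ⊓ (S.P i ⊓ S.Q (ρ + τ + d - i))) (ρ:ℤ)) ?_
  have hmem := h.swap.e_mem hD w hw
  refine ⟨hmem, fun k hk hj => ?_, fun k hk hj => ?_⟩
  · rw [S.swap.e_mul k hk ρ hD, if_neg (by omega)]
  · exact Irr.e_zero hk (by rw [hs, Set.mem_Icc]; omega) hmem

theorem L2 {W : Submodule ℂ V} (h : S.Irr W) {τ δ ρ d : ℕ}
    (hs : S.supp W = Set.Icc τ (τ+δ)) (hs' : S.swap.supp W = Set.Icc ρ (ρ+d)) {i j : ℤ}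
    (hij : ρ + τ + d < i + j) {v : V} (hv : v ∈ W) (hP : v ∈ S.P i)
    (hQ : v ∈ S.Q j) : v ∈ (S.P (i-1) ⊓ S.Q j) ⊔ (S.P i ⊓ S.Q (j-1)) := by
  have hv' := hv
  rw [← diag_top h hs hs', diag, Submodule.mem_iSup_iff_exists_finsupp] at hv'
  obtain ⟨f, hf, hfv⟩ := hv'
  have hsum : ∀ m ∈ f.support, f m = v - ∑ x ∈ f.support.erase m, f x := by
    intro m hm
    rw [← hfv, Finsupp.sum, ← Finset.add_sum_erase _ _ hm, add_sub_cancel_right]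
  have c1 : ∀ m ∈ f.support, m ≤ i := by
    intro m hm
    by_contra hc
    obtain ⟨M, hM, hMm⟩ := f.support.exists_max_image id ⟨m, hm⟩
    have hMi : i < M := lt_of_lt_of_le (not_le.mp hc) (hMm m hm)
    have : f M ∈ S.P (M-1) := by
      rw [hsum M hM]
      refine sub_mem (S.P_mono (by omega) hP) (sum_mem fun y hy => ?_)
      rw [Finset.mem_erase] at hy
      have := hMm y hy.2
      simp only [id] at this
      exact S.P_mono (by omega) (hf y).2.1
    exact Finsupp.mem_support_iff.mp hM
      (L1 h hs hs' (by omega) (hf M).1 this (hf M).2.2)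
  have c2 : ∀ m ∈ f.support, ρ + τ + d - m ≤ j := by
    intro m hm
    by_contra hc
    obtain ⟨M, hM, hMm⟩ := f.support.exists_min_image id ⟨m, hm⟩
    have hMi := hMm m hm
    simp only [id] at hMi
    have : f M ∈ S.Q (ρ + τ + d - M-1) := by
      rw [hsum M hM]
      refine sub_mem (S.Q_mono (by omega) hQ) (sum_mem fun y hy => ?_)
      rw [Finset.mem_erase] at hy
      have := hMm y hy.2
      simp only [id] at this
      exact S.Q_mono (by omega) (hf y).2.2
    exact Finsupp.mem_support_iff.mp hM
      (L1 h hs hs' (by omega) (hf M).1 (hf M).2.1 this)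
  rw [← hfv]
  refine sum_mem fun m hm => ?_
  have h1 := c1 m hm
  have h2 := c2 m hm
  by_cases hmi : m < i
  · exact Submodule.mem_sup_left ⟨S.P_mono (by omega) (hf m).2.1, S.Q_mono (by omega) (hf m).2.2⟩
  · exact Submodule.mem_sup_right ⟨S.P_mono (by omega) (hf m).2.1, S.Q_mono (by omega) (hf m).2.2⟩

end TDS
namespace QPolyDRG
variable {X : Type*} [Fintype X] [DecidableEq X] (S : QPolyDRG X) (x : X)

theorem card_ne (S : QPolyDRG X) : (Fintype.card X : ℂ) ≠ 0 := by
  have : Nonempty X := S.conn.nonempty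
  exact_mod_cast Fintype.card_ne_zero

theorem E_mul_sum {n : ℕ} (hn : n ≤ S.D) (c : ℕ → ℂ) :
    S.E n * ∑ h ∈ Finset.range (S.D + 1), c h • S.E h = c n • S.E n := by
  rw [Finset.mul_sum, Finset.sum_eq_single n]
  · rw [Matrix.mul_smul, S.hEmul n hn n hn, if_pos rfl]
  · intro b hb hbn
    rw [Matrix.mul_smul, S.hEmul n hn b (by simpa [Nat.lt_succ_iff] using hb), if_neg hbn.symm,
      smul_zero]
  · intro h; exact absurd (Finset.mem_range.mpr (by omega)) h

theorem E_ne : ∀ i ≤ S.D, S.E i ≠ 0 := by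
  intro i
  induction i with
  | zero =>
    intro _ h
    have := S.conn.nonempty
    obtain ⟨y⟩ := this
    have h2 := congrFun (congrFun h y) y
    rw [S.hE0] at h2
    simp [S.card_ne] at h2
  | succ n ih =>
    intro hn h
    have hD := S.hD3
    have hk := S.hKrein 1 (by omega) (n+1) hn
    rw [h, Matrix.hadamard_zero] at hk
    have hk2 := congrArg (fun M => S.E n * M) hk
    simp only [Matrix.mul_zero, Matrix.mul_smul] at hk2
    rw [S.E_mul_sum (n := n) (by omega) (fun h => (S.q h 1 (n+1) : ℂ))] at hk2
    have hq := S.hq_ne n (by omega) 1 (by omega) (n+1) hn (by omega)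
    have := ih (by omega)
    have hc := S.card_ne
    have h5 := (smul_eq_zero.mp hk2.symm).resolve_left (inv_ne_zero hc)
    have h6 := (smul_eq_zero.mp h5).resolve_right this
    exact hq (by exact_mod_cast h6)

theorem adj_transpose : S.adjᵀ = S.adj := by
  ext y z
  simp only [adj, Amat, Matrix.transpose_apply, Matrix.of_apply]
  rw [SimpleGraph.dist_comm]

theorem adj_E {i : ℕ} (hi : i ≤ S.D) : S.adj * S.E i = (S.θ i : ℂ) • S.E i := S.hAE i hi

theorem E_adj {i : ℕ} (hi : i ≤ S.D) : S.E i * S.adj = (S.θ i : ℂ) • S.E i := by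
  have := congrArg Matrix.transpose (S.adj_E hi)
  rwa [Matrix.transpose_mul, S.adj_transpose, Matrix.transpose_smul, S.hEsym i hi] at this

theorem aeval_E (p : Polynomial ℂ) {i : ℕ} (hi : i ≤ S.D) :
    Polynomial.aeval S.adj p * S.E i = p.eval (S.θ i : ℂ) • S.E i := by
  induction p using Polynomial.induction_on' with
  | add p q hp hq => rw [map_add, add_mul, hp, hq, Polynomial.eval_add, add_smul]
  | monomial n a =>
    rw [Polynomial.aeval_monomial, Polynomial.eval_monomial]
    have : S.adj ^ n * S.E i = (S.θ i : ℂ) ^ n • S.E i := by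
      induction n with
      | zero => simp
      | succ n ih => rw [pow_succ, mul_assoc, S.adj_E hi, Matrix.mul_smul, ih, smul_smul, pow_succ, mul_comm]
    rw [mul_assoc, this, Matrix.mul_smul, ← Algebra.smul_def, smul_smul, mul_comm]

theorem E_mem_adjoin {i : ℕ} (hi : i ≤ S.D) : S.E i ∈ Algebra.adjoin ℂ {S.adj} := by
  have hinj : Set.InjOn (fun k => (S.θ k : ℂ)) (Finset.range (S.D+1) : Set ℕ) := by
    intro a ha b hb hab
    simp only [Finset.coe_range, Set.mem_Iio] at ha hb
    exact S.θ_inj a (by omega) b (by omega) (Complex.ofReal_injective hab)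
  have hir : i ∈ Finset.range (S.D+1) := Finset.mem_range.mpr (by omega)
  have : S.E i = Polynomial.aeval S.adj
      (Lagrange.basis (Finset.range (S.D+1)) (fun k => (S.θ k : ℂ)) i) := by
    conv_rhs => rw [← mul_one (Polynomial.aeval _ _), ← S.hEsum, Finset.mul_sum]
    rw [Finset.sum_eq_single i]
    · rw [S.aeval_E _ hi, Lagrange.eval_basis_self hinj hir, one_smul]
    · intro b hb hbi
      rw [S.aeval_E _ (by simpa [Nat.lt_succ_iff] using hb),
        Lagrange.eval_basis_of_ne (v := fun k => (S.θ k : ℂ)) hbi.symm hb, zero_smul]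
    · intro h; exact absurd hir h
  rw [this]
  exact Polynomial.aeval_mem_adjoin_singleton _ _

theorem Estar_sum : ∑ i ∈ Finset.range (S.D + 1), S.Estar x i = 1 := by
  ext y z
  rw [Matrix.sum_apply]
  by_cases h : y = z
  · subst h
    have := S.dist_le x y
    simp only [Estar, Matrix.diagonal_apply_eq, Matrix.one_apply_eq]
    rw [Finset.sum_ite_eq, if_pos (Finset.mem_range.mpr (by omega))]
  · simp [Estar, h]

theorem Estar_mul (i j : ℕ) : S.Estar x i * S.Estar x j = if i = j then S.Estar x i else 0 := by
  unfold Estar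
  rw [Matrix.diagonal_mul_diagonal]
  split_ifs with h
  · subst h; congr 1; ext y; simp
  · rw [← Matrix.diagonal_zero]; congr 1; ext y
    simp only [mul_ite, mul_one, mul_zero]
    split_ifs <;> first | omega | rfl

theorem E1_dist : ∃ c : ℕ → ℂ, ∀ y z, S.E 1 y z = c (S.G.dist y z) := by
  have := S.hEinM 1 (by have := S.hD3; omega)
  generalize S.E 1 = M at this
  induction this using Submodule.span_induction with
  | mem B hB =>
    obtain ⟨k, _, rfl⟩ := hB
    exact ⟨fun n => if n = k then 1 else 0, fun y z => rfl⟩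
  | zero => exact ⟨0, fun y z => rfl⟩
  | add B C _ _ hB hC =>
    obtain ⟨b, hb⟩ := hB
    obtain ⟨c, hc⟩ := hC
    exact ⟨b + c, fun y z => by simp [hb, hc]⟩
  | smul a B _ hB =>
    obtain ⟨b, hb⟩ := hB
    exact ⟨a • b, fun y z => by simp [hb]⟩

theorem Estar_Astar : ∃ c : ℕ → ℂ, ∀ i, S.Estar x i * S.Astar x = c i • S.Estar x i := by
  obtain ⟨c, hc⟩ := S.E1_dist
  refine ⟨fun i => Fintype.card X * c i, fun i => ?_⟩
  unfold Estar Astar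
  rw [Matrix.diagonal_mul_diagonal, ← Matrix.diagonal_smul]
  congr 1
  ext y
  simp only [hc, Pi.smul_apply, smul_eq_mul]
  split_ifs with h
  · rw [h]; ring
  · ring

/-- row-to-diagonal map -/
def rowDiag : Matrix X X ℂ →ₗ[ℂ] Matrix X X ℂ where
  toFun M := Matrix.diagonal (fun y => M x y)
  map_add' M N := by rw [Matrix.diagonal_add]; rfl
  map_smul' c M := by rw [RingHom.id_apply, ← Matrix.diagonal_smul]; rfl

theorem rowDiag_mul (M N : Matrix X X ℂ) :
    rowDiag x M * rowDiag x N = rowDiag x (Matrix.hadamard M N) := by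
  simp [rowDiag, Matrix.diagonal_mul_diagonal]

theorem Astar_eq : S.Astar x = (Fintype.card X : ℂ) • rowDiag x (S.E 1) := by
  simp only [Astar, rowDiag, LinearMap.coe_mk, AddHom.coe_mk]
  rw [← Matrix.diagonal_smul]; rfl

theorem rowDiag_E_mem : ∀ i ≤ S.D, rowDiag x (S.E i) ∈ Algebra.adjoin ℂ {S.Astar x} := by
  intro i
  induction i using Nat.strong_induction_on with
  | _ i ih =>
    intro hi
    have hD := S.hD3
    match i, ih, hi with
    | 0, ih, hi =>
      have : rowDiag x (S.E 0) = (Fintype.card X : ℂ)⁻¹ • 1 := by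
        rw [S.hE0, map_smul, ← Matrix.diagonal_one]
        rfl
      rw [this]
      exact Subalgebra.smul_mem _ (one_mem _) _
    | n+1, ih, hi =>
      have h1 := S.hKrein 1 (by omega) n (by omega)
      have h2 := congrArg (rowDiag x) h1
      rw [← rowDiag_mul, map_smul, map_sum] at h2
      have h3 : S.Astar x * rowDiag x (S.E n) =
          ∑ h ∈ Finset.range (S.D+1), (S.q h 1 n : ℂ) • rowDiag x (S.E h) := by
        rw [S.Astar_eq, Matrix.smul_mul, h2, smul_smul, mul_inv_cancel₀ S.card_ne, one_smul]
        exact Finset.sum_congr rfl fun h _ => map_smul _ _ _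
      have hmem : n + 1 ∈ Finset.range (S.D+1) := Finset.mem_range.mpr (by omega)
      rw [← Finset.add_sum_erase _ _ hmem] at h3
      have hq := S.hq_ne (n+1) hi 1 (by omega) n (by omega) (by omega)
      have hq' : (S.q (n+1) 1 n : ℂ) ≠ 0 := by exact_mod_cast hq
      have h4 : rowDiag x (S.E (n+1)) = (S.q (n+1) 1 n : ℂ)⁻¹ • (S.Astar x * rowDiag x (S.E n) -
          ∑ h ∈ (Finset.range (S.D+1)).erase (n+1), (S.q h 1 n : ℂ) • rowDiag x (S.E h)) := by
        rw [h3, add_sub_cancel_right, smul_smul, inv_mul_cancel₀ hq', one_smul]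
      rw [h4]
      have hA : S.Astar x ∈ Algebra.adjoin ℂ {S.Astar x} :=
        Algebra.subset_adjoin (Set.mem_singleton _)
      refine Subalgebra.smul_mem _ (Subalgebra.sub_mem _ (Subalgebra.mul_mem _ hA
        (ih n (by omega) (by omega))) (Subalgebra.sum_mem _ fun h hh => ?_)) _
      rw [Finset.mem_erase, Finset.mem_range] at hh
      by_cases hn : h < n + 1
      · exact Subalgebra.smul_mem _ (ih h hn (by omega)) _
      · rw [S.hq_zero h (by omega) 1 (by omega) n (by omega) (by omega)]
        simp

theorem Amat_mem {k : ℕ} (hk : k ≤ S.D) :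
    S.Amat k ∈ Submodule.span ℂ (Set.range fun i : Fin (S.D+1) => S.E i) := by
  have hli : LinearIndependent ℂ (fun i : Fin (S.D+1) => S.E i) := by
    rw [Fintype.linearIndependent_iff]
    intro g hg i
    have h1 := congrArg (fun M => S.E i * M) hg
    simp only [Matrix.mul_zero, Finset.mul_sum, Matrix.mul_smul] at h1
    rw [Finset.sum_eq_single i, S.hEmul i (by omega) i (by omega), if_pos rfl] at h1
    · exact (smul_eq_zero.mp h1).resolve_right (S.E_ne i (by omega))
    · intro b _ hb
      rw [S.hEmul i (by omega) b (by omega), if_neg (fun h => hb (Fin.ext h.symm)), smul_zero]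
    · simp
  have hle : Submodule.span ℂ (Set.range fun i : Fin (S.D+1) => S.E i) ≤
      Submodule.span ℂ (Set.range fun i : Fin (S.D+1) => S.Amat i) := by
    rw [Submodule.span_le]
    rintro _ ⟨i, rfl⟩
    refine Submodule.span_mono ?_ (S.hEinM i (by omega))
    rintro B ⟨k, hk, rfl⟩
    exact ⟨⟨k, by omega⟩, rfl⟩
  have hfr : Module.finrank ℂ (Submodule.span ℂ (Set.range fun i : Fin (S.D+1) => S.Amat i)) ≤
      Module.finrank ℂ (Submodule.span ℂ (Set.range fun i : Fin (S.D+1) => S.E i)) := by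
    rw [finrank_span_eq_card hli]
    exact finrank_range_le_card _
  rw [Submodule.eq_of_le_of_finrank_le hle hfr]
  exact Submodule.subset_span ⟨⟨k, by omega⟩, rfl⟩

theorem Estar_mem_adjoin {k : ℕ} (hk : k ≤ S.D) : S.Estar x k ∈ Algebra.adjoin ℂ {S.Astar x} := by
  have h1 : S.Estar x k = rowDiag x (S.Amat k) := rfl
  rw [h1]
  have h2 : Submodule.span ℂ (Set.range fun i : Fin (S.D+1) => S.E i) ≤
      (Subalgebra.toSubmodule (Algebra.adjoin ℂ {S.Astar x})).comap (rowDiag x) := by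
    rw [Submodule.span_le]
    rintro _ ⟨i, rfl⟩
    exact S.rowDiag_E_mem x i (by omega)
  exact h2 (S.Amat_mem hk)

theorem tris {k l : ℕ} (h : l + 1 < k) : S.Estar x k * S.adj * S.Estar x l = 0 := by
  ext y z
  simp only [Estar, adj, Amat, Matrix.mul_diagonal, Matrix.diagonal_mul, Matrix.of_apply,
    Matrix.zero_apply]
  split_ifs with h1 h2 h3 <;> simp
  have := S.conn.dist_triangle (u := x) (v := z) (w := y)
  rw [SimpleGraph.dist_comm (u := z)] at this
  omega

theorem E_conj {i : ℕ} (hi : i ≤ S.D) (y z : X) : star (S.E i y z) = S.E i y z :=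
  Complex.conj_eq_iff_im.mpr (S.hEreal i hi y z)

theorem E_sym {i : ℕ} (hi : i ≤ S.D) (y z : X) : S.E i y z = S.E i z y :=
  congrFun (congrFun (S.hEsym i hi) z) y

theorem E_conjT {i : ℕ} (hi : i ≤ S.D) : (S.E i)ᴴ = S.E i := by
  ext y z
  rw [Matrix.conjTranspose_apply, S.E_conj hi, S.E_sym hi]

theorem Astar_conjT : (S.Astar x)ᴴ = S.Astar x := by
  have hD := S.hD3
  unfold Astar
  rw [Matrix.diagonal_conjTranspose]
  congr 1
  ext y
  have := S.E_conj (i := 1) (by omega) x y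
  simp only [Pi.star_apply, star_mul', this]
  simp

open scoped ComplexOrder in
theorem tri {k l : ℕ} (hk : k ≤ S.D) (hl : l ≤ S.D) (h : l + 1 < k) :
    S.E k * S.Astar x * S.E l = 0 := by
  have hD := S.hD3
  rw [← Matrix.trace_mul_conjTranspose_self_eq_zero_iff]
  rw [Matrix.conjTranspose_mul, Matrix.conjTranspose_mul, S.E_conjT hk, S.E_conjT hl, S.Astar_conjT]
  have e1 : S.E k * S.Astar x * S.E l * (S.E l * (S.Astar x * S.E k)) =
      S.E k * (S.Astar x * S.E l * S.Astar x * S.E k) := by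
    have := S.hEmul l hl l hl
    rw [if_pos rfl] at this
    simp only [Matrix.mul_assoc]
    rw [← Matrix.mul_assoc (S.E l) (S.E l), this]
  have e2 : S.Astar x * S.E l * S.Astar x * S.E k * S.E k = (S.Astar x * S.E l * S.Astar x) * S.E k := by
    have := S.hEmul k hk k hk
    rw [if_pos rfl] at this
    rw [Matrix.mul_assoc _ (S.E k), this]
  rw [e1, Matrix.trace_mul_comm, e2]
  have e3 : Matrix.trace ((S.Astar x * S.E l * S.Astar x) * S.E k) =
      (Fintype.card X : ℂ)^2 * (S.E 1 * Matrix.hadamard (S.E k) (S.E l) * S.E 1) x x := by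
    simp only [Matrix.trace, Matrix.diag]
    rw [Matrix.mul_apply, Finset.mul_sum]
    refine Finset.sum_congr rfl fun z _ => ?_
    rw [Matrix.mul_apply]
    simp only [Astar, Matrix.mul_diagonal, Matrix.diagonal_mul]
    rw [Matrix.mul_apply, Finset.sum_mul, Finset.mul_sum]
    refine Finset.sum_congr rfl fun y _ => ?_
    have h1 : S.E 1 z x = S.E 1 x z := by
      exact S.E_sym (by omega) z x
    have h2 : S.E l z y = S.E l y z := by
      exact S.E_sym hl z y
    rw [h1, h2, Matrix.hadamard_apply]
    ring
  rw [e3, S.hKrein k hk l hl, Matrix.mul_smul, S.E_mul_sum (n := 1) (by omega)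
    (fun h => (S.q h k l : ℂ)), S.hq_zero 1 (by omega) k hk l hl (by omega)]
  simp

/-- the abstract data -/
def tds : TDS (EuclideanSpace ℂ X) where
  D := S.D
  e i := Matrix.toEuclideanLin (S.E i)
  es i := Matrix.toEuclideanLin (S.Estar x i)
  A := Matrix.toEuclideanLin S.adj
  As := Matrix.toEuclideanLin (S.Astar x)
  θ i := S.θ i
  θs := (S.Estar_Astar x).choose
  e_sum v := by
    rw [← LinearMap.sum_apply, ← map_sum, S.hEsum, Matrix.toLpLin_one]; rfl
  es_sum v := by
    rw [← LinearMap.sum_apply, ← map_sum, S.Estar_sum, Matrix.toLpLin_one]; rfl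
  e_mul i hi j hj v := by
    rw [← LinearMap.comp_apply, ← Matrix.toLpLin_mul, S.hEmul i hi j hj]
    split_ifs <;> simp
  es_mul i hi j hj v := by
    rw [← LinearMap.comp_apply, ← Matrix.toLpLin_mul, S.Estar_mul]
    split_ifs <;> simp
  e_A i hi v := by
    rw [← LinearMap.comp_apply, ← Matrix.toLpLin_mul, S.E_adj hi, map_smul]; rfl
  es_As i hi v := by
    rw [← LinearMap.comp_apply, ← Matrix.toLpLin_mul, (S.Estar_Astar x).choose_spec i, map_smul]; rfl
  e_mem i hi := by
    have h := S.E_mem_adjoin hi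
    have h2 := Subalgebra.mem_map.mpr ⟨_, h, (rfl : (Matrix.toLpLinAlgEquiv (R := ℂ) (n := X) 2).toAlgHom _ = _)⟩
    rw [AlgHom.map_adjoin, Set.image_singleton] at h2
    exact h2
  es_mem i hi := by
    have h := S.Estar_mem_adjoin x hi
    have h2 := Subalgebra.mem_map.mpr ⟨_, h, (rfl : (Matrix.toLpLinAlgEquiv (R := ℂ) (n := X) 2).toAlgHom _ = _)⟩
    rw [AlgHom.map_adjoin, Set.image_singleton] at h2
    exact h2
  tri k hk l hl h v := by
    rw [← LinearMap.comp_apply, ← LinearMap.comp_apply, ← Matrix.toLpLin_mul 2 2 2,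
      ← Matrix.toLpLin_mul 2 2 2, S.tri x hk hl h]
    simp
  tris k hk l hl h v := by
    rw [← LinearMap.comp_apply, ← LinearMap.comp_apply, ← Matrix.toLpLin_mul 2 2 2,
      ← Matrix.toLpLin_mul 2 2 2, S.tris x h]
    simp

end QPolyDRG
namespace TDS
variable {V : Type*} [AddCommGroup V] [Module ℂ V] {S : TDS V}

theorem iSup_eq {W : Submodule ℂ V} (hW : ∀ k ≤ S.D, ∀ w ∈ W, S.e k w ∈ W) (s : Finset ℕ) (m : ℤ)
    (h1 : ∀ k ∈ s, (k : ℤ) ≤ m)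
    (h2 : ∀ k ≤ S.D, (k : ℤ) ≤ m → k ∉ s → ∀ w ∈ W, S.e k w = 0)
    (F : ℕ → Submodule ℂ V) (hF : ∀ k, F k = if k ≤ S.D then W.map (S.e k) else ⊥) :
    ⨆ k ∈ s, F k = W ⊓ S.Q m := by
  apply le_antisymm
  · refine iSup₂_le fun k hk => ?_
    rw [hF]
    split_ifs with hkD
    · rintro _ ⟨w, hw, rfl⟩
      refine ⟨hW k hkD w hw, fun l hl hml => ?_⟩
      have := h1 k hk
      rw [S.e_mul l hl k hkD, if_neg (by omega)]
    · exact bot_le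
  · rintro w ⟨hw, hq⟩
    rw [← S.e_sum w]
    refine sum_mem fun k hk => ?_
    have hkD : k ≤ S.D := by simpa [Nat.lt_succ_iff] using hk
    by_cases hkm : m < k
    · rw [hq k hkD hkm]; exact zero_mem _
    by_cases hks : k ∈ s
    · refine Submodule.mem_iSup_of_mem k (Submodule.mem_iSup_of_mem hks ?_)
      rw [hF, if_pos hkD]
      exact ⟨w, hw, rfl⟩
    · rw [h2 k hkD (by omega) hks w hw]; exact zero_mem _

end TDS

namespace QPolyDRG
variable {X : Type*} [Fintype X] [DecidableEq X] (S : QPolyDRG X) (x : X)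

theorem isT_of {W : Submodule ℂ (EuclideanSpace ℂ X)} (h1 : ∀ w ∈ W, (S.tds x).A w ∈ W)
    (h2 : ∀ w ∈ W, (S.tds x).As w ∈ W) : S.IsTModule x W := by
  intro B hB
  unfold Talg at hB
  induction hB using Algebra.adjoin_induction with
  | mem B hB =>
    rcases hB with rfl | hB
    · exact h1
    · rw [Set.mem_singleton_iff] at hB; subst hB; exact h2
  | algebraMap r =>
    intro w hw
    rw [Algebra.algebraMap_eq_smul_one, map_smul, Matrix.toLpLin_one]
    exact W.smul_mem r hw
  | add B C _ _ hB hC =>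
    intro w hw
    rw [map_add]
    exact W.add_mem (hB w hw) (hC w hw)
  | mul B C _ _ hB hC =>
    intro w hw
    rw [Matrix.toLpLin_mul 2 2 2]
    exact hB _ (hC w hw)

theorem irr_of {W : Submodule ℂ (EuclideanSpace ℂ X)} (h : S.IsIrredTModule x W) :
    (S.tds x).Irr W where
  hA := h.1 _ (Algebra.subset_adjoin (by simp))
  hAs := h.1 _ (Algebra.subset_adjoin (by simp))
  ne := h.2.1
  irr N hN h1 h2 := h.2.2 N hN (S.isT_of x h1 h2)

variable (W : Submodule ℂ (EuclideanSpace ℂ X))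

theorem EW_eq (k : ℕ) : S.EW W k = if k ≤ (S.tds x).D then W.map ((S.tds x).e k) else ⊥ := by
  simp [EW, tds]
  rfl

theorem EstarW_eq (k : ℕ) : S.EstarW x W k =
    if k ≤ (S.tds x).swap.D then W.map ((S.tds x).swap.e k) else ⊥ := by
  simp [EstarW, tds, TDS.swap]
  rfl

theorem EV_eq (k : ℕ) : S.EV k =
    if k ≤ (S.tds x).D then (⊤ : Submodule ℂ (EuclideanSpace ℂ X)).map ((S.tds x).e k) else ⊥ := by
  simp [EV, tds]

theorem EstarV_eq (k : ℕ) : S.EstarV x k = if k ≤ (S.tds x).swap.D then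
    (⊤ : Submodule ℂ (EuclideanSpace ℂ X)).map ((S.tds x).swap.e k) else ⊥ := by
  simp [EstarV, tds, TDS.swap]

theorem map_ne_bot {U : Type*} [AddCommGroup U] [Module ℂ U] (f : Module.End ℂ U)
    (W : Submodule ℂ U) : W.map f ≠ ⊥ ↔ ∃ w ∈ W, f w ≠ 0 := by
  rw [Submodule.ne_bot_iff]
  constructor
  · rintro ⟨_, ⟨w, hw, rfl⟩, h⟩; exact ⟨w, hw, h⟩
  · rintro ⟨w, hw, h⟩; exact ⟨_, ⟨w, hw, rfl⟩, h⟩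

theorem supp_eq : {i : ℕ | i ≤ S.D ∧ S.EW W i ≠ ⊥} = (S.tds x).supp W := by
  ext i
  refine and_congr_right fun hi => ?_
  rw [S.EW_eq x, if_pos (show i ≤ (S.tds x).D from hi), map_ne_bot]

theorem supps_eq : {i : ℕ | i ≤ S.D ∧ S.EstarW x W i ≠ ⊥} = (S.tds x).swap.supp W := by
  ext i
  refine and_congr_right fun hi => ?_
  rw [S.EstarW_eq x, if_pos (show i ≤ (S.tds x).swap.D from hi), map_ne_bot]

theorem Vsplit_eq (i j : ℤ) : S.Vsplit x false false i j = (S.tds x).P i ⊓ (S.tds x).Q j := by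
  unfold Vsplit
  split_ifs with h h'
  · exact absurd h' (by simp)
  · rw [TDS.iSup_eq (S := (S.tds x).swap) (W := ⊤) (fun _ _ _ _ => trivial) _ i
      (fun k hk => by rw [Finset.mem_range] at hk; omega)
      (fun k _ hk hks => absurd (Finset.mem_range.mpr (by omega)) hks) _ (S.EstarV_eq x),
      TDS.iSup_eq (S := (S.tds x)) (W := ⊤) (fun _ _ _ _ => trivial) _ j
      (fun k hk => by rw [Finset.mem_range] at hk; omega)
      (fun k _ hk hks => absurd (Finset.mem_range.mpr (by omega)) hks) _ (S.EV_eq x),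
      top_inf_eq, top_inf_eq]
    rfl
  · symm
    rw [Submodule.eq_bot_iff]
    rintro v ⟨hP, hQ⟩
    by_cases hi : 0 ≤ i
    · exact TDS.eq_zero_of_e (S := S.tds x) fun k hk => hQ k hk (by omega)
    · exact TDS.eq_zero_of_e (S := (S.tds x).swap) fun k hk => hP k hk (by omega)

variable {W}

theorem Wsplit_eq (h : (S.tds x).Irr W) {τ ρ d δ : ℕ}
    (hs : (S.tds x).supp W = Set.Icc τ (τ+δ)) (hs' : (S.tds x).swap.supp W = Set.Icc ρ (ρ+d))
    {m : ℕ} (hm : m ≤ d) :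
    S.Wsplit x W ρ τ d false false m =
      W ⊓ ((S.tds x).P (ρ + m) ⊓ (S.tds x).Q (τ + d - m)) := by
  unfold Wsplit
  simp only [Bool.false_eq_true, if_false]
  rw [TDS.iSup_eq (S := (S.tds x).swap) (W := W) (fun k hk => h.swap.e_mem hk) _ (ρ + m)
      (fun k hk => by rw [Finset.mem_Icc] at hk; omega)
      (fun k hkD hk hks w hw => TDS.Irr.e_zero hkD (by
        rw [hs', Set.mem_Icc]; rw [Finset.mem_Icc] at hks; omega) hw) _ (S.EstarW_eq x W),
      TDS.iSup_eq (S := (S.tds x)) (W := W) (fun k hk => h.e_mem hk) _ (τ + d - m)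
      (fun k hk => by rw [Finset.mem_Icc] at hk; omega)
      (fun k hkD hk hks w hw => TDS.Irr.e_zero hkD (by
        rw [hs, Set.mem_Icc]; rw [Finset.mem_Icc] at hks; omega) hw) _ (S.EW_eq x W)]
  rw [inf_inf_inf_comm, inf_idem]
  rfl

theorem sInf_Icc (a b : ℕ) : sInf (Set.Icc a (a+b)) = a := by
  have : IsLeast (Set.Icc a (a+b)) a := isLeast_Icc (by omega)
  exact this.csInf_eq

theorem params (h : (S.tds x).Irr W) : (S.tds x).supp W =
      Set.Icc (S.dualEndpt W) (S.dualEndpt W + S.diam x W) ∧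
    (S.tds x).swap.supp W = Set.Icc (S.endpt x W) (S.endpt x W + S.diam x W) := by
  obtain ⟨τ, δ, hs⟩ := h.contig
  obtain ⟨ρ, d, hs'⟩ := h.swap.contig
  have hd := TDS.diam_eq h hs hs'
  have e1 : S.dualEndpt W = τ := by
    unfold dualEndpt; rw [S.supp_eq x, hs, sInf_Icc]
  have e2 : S.endpt x W = ρ := by
    unfold endpt; rw [S.supps_eq x, hs', sInf_Icc]
  have e3 : S.diam x W = d := by
    unfold diam
    rw [S.supps_eq x, hs', ← Finset.coe_Icc, Set.ncard_coe_finset, Nat.card_Icc]; omega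
  rw [e1, e2, e3, hs, hs', hd]
  exact ⟨rfl, rfl⟩

/-- components of an element of `P i ⊓ Q j` -/
theorem comp_mem {ι : Type*} (Ws : ι → Submodule ℂ (EuclideanSpace ℂ X))
    (hirr : ∀ k, (S.tds x).Irr (Ws k))
    (horth : ∀ k l, k ≠ l → ∀ u ∈ Ws k, ∀ v ∈ Ws l, ⟪u, v⟫ = 0)
    (hsup : (⨆ k, Ws k) = ⊤) {i j : ℤ} {v : EuclideanSpace ℂ X}
    (hv : v ∈ (S.tds x).P i ⊓ (S.tds x).Q j) :
    ∃ f : ι →₀ EuclideanSpace ℂ X, (∀ k, f k ∈ Ws k ⊓ ((S.tds x).P i ⊓ (S.tds x).Q j)) ∧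
      (f.sum fun _ w => w) = v := by
  have hv' : v ∈ ⨆ k, Ws k := by rw [hsup]; trivial
  rw [Submodule.mem_iSup_iff_exists_finsupp] at hv'
  obtain ⟨f, hf, hfv⟩ := hv'
  refine ⟨f, ?_, hfv⟩
  have key : ∀ (g : Module.End ℂ (EuclideanSpace ℂ X)), (∀ k, ∀ w ∈ Ws k, g w ∈ Ws k) →
      g v = 0 → ∀ k, g (f k) = 0 := by
    intro g hg hgv k
    rw [← inner_self_eq_zero (𝕜 := ℂ)]
    have h1 : ⟪g (f k), g v⟫ = ⟪g (f k), g (f k)⟫ := by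
      rw [← hfv, Finsupp.sum, map_sum, inner_sum, Finset.sum_eq_single k]
      · intro b _ hb
        exact horth k b hb.symm _ (hg k _ (hf k)) _ (hg b _ (hf b))
      · intro hk
        rw [Finsupp.notMem_support_iff.mp hk]; simp
    rw [← h1, hgv, inner_zero_right]
  intro k
  refine ⟨hf k, fun l hl hli => ?_, fun l hl hlj => ?_⟩
  · exact key _ (fun k => (hirr k).swap.e_mem hl) (hv.1 l hl hli) k
  · exact key _ (fun k => (hirr k).e_mem hl) (hv.2 l hl hlj) k

end QPolyDRG

open QPolyDRG in
/-- Fix an orthogonal direct sum decomposition `V = Σ_W W` of the standard module into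
irreducible `T`-modules.  Then `Ṽ^{↓↓}_{i,j} = Σ W^{↓↓}_h`, the sum being over all ordered
pairs `(W, h)` such that `W` occurs in the decomposition with endpoint `ρ ≤ i`, dual
endpoint `τ = i + j - ρ - d`, diameter `d ≥ i - ρ`, and `h = i - ρ`. -/
theorem drg_tildeV_dd_sum {X : Type*} [Fintype X] [DecidableEq X] (S : QPolyDRG X) (x : X)
    (ι : Type*) (Ws : ι → Submodule ℂ (EuclideanSpace ℂ X))
    (hirr : ∀ k, S.IsIrredTModule x (Ws k))
    (horth : ∀ k l, k ≠ l → ∀ u ∈ Ws k, ∀ v ∈ Ws l, ⟪u, v⟫ = 0)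
    (hsup : (⨆ k, Ws k) = ⊤) :
    ∀ i : ℕ, i ≤ S.D → ∀ j : ℕ, j ≤ S.D →
      S.tildeV x false false i j =
        ⨆ (k : ι) (_ : S.endpt x (Ws k) ≤ i ∧
            ((S.dualEndpt (Ws k) : ℤ) = i + j - S.endpt x (Ws k) - S.diam x (Ws k)) ∧
            i - S.endpt x (Ws k) ≤ S.diam x (Ws k)),
          S.Wsplit x (Ws k) (S.endpt x (Ws k)) (S.dualEndpt (Ws k)) (S.diam x (Ws k))
            false false (i - S.endpt x (Ws k)) := by
  intro i hi j hj
  have hirr' := fun k => S.irr_of x (hirr k)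
  unfold tildeV
  rw [S.Vsplit_eq, S.Vsplit_eq, S.Vsplit_eq]
  set T := S.tds x with hT
  set R : Submodule ℂ (EuclideanSpace ℂ X) := ⨆ (k : ι) (_ : S.endpt x (Ws k) ≤ i ∧
            ((S.dualEndpt (Ws k) : ℤ) = i + j - S.endpt x (Ws k) - S.diam x (Ws k)) ∧
            i - S.endpt x (Ws k) ≤ S.diam x (Ws k)),
          S.Wsplit x (Ws k) (S.endpt x (Ws k)) (S.dualEndpt (Ws k)) (S.diam x (Ws k))
            false false (i - S.endpt x (Ws k)) with hR
  have good : ∀ k, (S.endpt x (Ws k) ≤ i ∧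
            ((S.dualEndpt (Ws k) : ℤ) = i + j - S.endpt x (Ws k) - S.diam x (Ws k)) ∧
            i - S.endpt x (Ws k) ≤ S.diam x (Ws k)) →
      S.Wsplit x (Ws k) (S.endpt x (Ws k)) (S.dualEndpt (Ws k)) (S.diam x (Ws k))
            false false (i - S.endpt x (Ws k)) = Ws k ⊓ (T.P i ⊓ T.Q j) := by
    rintro k ⟨g1, g2, g3⟩
    obtain ⟨hs, hs'⟩ := S.params x (hirr' k)
    rw [S.Wsplit_eq x (hirr' k) hs hs' g3]
    congr 3
    · omega
    · omega
  have le1 : R ≤ (T.P i ⊓ T.Q j) ⊓ ((T.P ((i:ℤ)-1) ⊓ T.Q j) ⊔ (T.P i ⊓ T.Q ((j:ℤ)-1)))ᗮ := by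
    refine iSup₂_le fun k hk => ?_
    rw [good k hk]
    obtain ⟨hs, hs'⟩ := S.params x (hirr' k)
    rintro v ⟨hvW, hvU⟩
    refine ⟨hvU, ?_⟩
    have orth : ∀ i' j' : ℤ, i' + j' < i + j → T.P i' ⊓ T.Q j' ≤ (ℂ ∙ v)ᗮ := by
      intro i' j' hij u hu
      obtain ⟨f, hf, hfu⟩ := S.comp_mem x Ws hirr' horth hsup hu
      rw [Submodule.mem_orthogonal_singleton_iff_inner_right, ← hfu, Finsupp.sum, inner_sum]
      refine Finset.sum_eq_zero fun l _ => ?_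
      by_cases hl : k = l
      · subst hl
        have : f k = 0 := TDS.L1 (hirr' k) hs hs' (by omega) (hf k).1 (hf k).2.1 (hf k).2.2
        rw [this, inner_zero_right]
      · exact horth k l hl v hvW _ (hf l).1
    have h3 := sup_le (orth ((i:ℤ)-1) j (by omega)) (orth i ((j:ℤ)-1) (by omega))
    refine (Submodule.mem_orthogonal _ _).mpr ?_
    intro u hu
    exact Submodule.mem_orthogonal_singleton_iff_inner_left.mp (h3 hu)
  refine le_antisymm ?_ le1
  rintro v ⟨hvU, hvO⟩
  obtain ⟨f, hf, hfv⟩ := S.comp_mem x Ws hirr' horth hsup hvU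
  have hmem : v ∈ R ⊔ ((T.P ((i:ℤ)-1) ⊓ T.Q j) ⊔ (T.P i ⊓ T.Q ((j:ℤ)-1))) := by
    rw [← hfv]
    refine sum_mem fun k _ => ?_
    obtain ⟨hs, hs'⟩ := S.params x (hirr' k)
    have hfk := hf k
    show f k ∈ _
    by_cases hk : (S.endpt x (Ws k) ≤ i ∧
            ((S.dualEndpt (Ws k) : ℤ) = i + j - S.endpt x (Ws k) - S.diam x (Ws k)) ∧
            i - S.endpt x (Ws k) ≤ S.diam x (Ws k))
    · refine Submodule.mem_sup_left (Submodule.mem_iSup_of_mem k (Submodule.mem_iSup_of_mem hk ?_))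
      rw [good k hk]
      exact hfk
    · by_cases hlt : (S.endpt x (Ws k) + S.dualEndpt (Ws k) + S.diam x (Ws k) : ℤ) < i + j
      · exact Submodule.mem_sup_right (TDS.L2 (hirr' k) hs hs' hlt hfk.1 hfk.2.1 hfk.2.2)
      · have : f k = 0 := TDS.L1 (hirr' k) hs hs' (by omega) hfk.1 hfk.2.1 hfk.2.2
        rw [this]; exact zero_mem _
  obtain ⟨r, hr, b, hb, hrb⟩ := Submodule.mem_sup.mp hmem
  have hbO : b ∈ ((T.P ((i:ℤ)-1) ⊓ T.Q j) ⊔ (T.P i ⊓ T.Q ((j:ℤ)-1)))ᗮ := by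
    have : b = v - r := by rw [← hrb]; abel
    rw [this]
    exact Submodule.sub_mem _ hvO (le1 hr).2
  have hb0 : b = 0 := by
    rw [← inner_self_eq_zero (𝕜 := ℂ)]
    exact (Submodule.mem_orthogonal _ _).mp hbO b hb
  rw [← hrb, hb0, add_zero]
  exact hr

end
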